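/- With τ := t_p/t_s and β_n, σ_1^(n), σ_2^(n) as defined from Bessel and Neumann function values, the following large-n asymptotics hold: β_n = i(τ^{−n} − τ^{n})(1 + O(1/n)), √(β_n² − 4) = i(τ^{−n} + τ^{n})(1 + O(1/n)), σ_1^(n) = i τ^{n} (1 + O(1/n)) and σ_2^(n) = −i τ^{−n} (1 + O(1/n)) as n → +∞. -/

import Mathlib

/- Common setup: two-dimensional linear elasticity, Navier equation, Kupradze radiation,
   far-field patterns and far-field operators, Bessel/Hankel matrices for the rigid disk. -/

noncomputable section

open Real MeasureTheory

/-- Points of the plane `ℝ²`. -/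
abbrev Pt : Type := Fin 2 → ℝ

/-- Complex 2-vectors (values of elastic displacement fields). -/
abbrev CV : Type := Fin 2 → ℂ

/-- Euclidean norm `|x|` on the plane. -/
def nrm (x : Pt) : ℝ := Real.sqrt (x 0 ^ 2 + x 1 ^ 2)

/-- Standard basis vectors of `ℝ²`. -/
def ebas (i : Fin 2) : Pt := fun j => if j = i then 1 else 0

/-- Partial derivative `∂ᵢ` of a scalar field. -/
def pd (i : Fin 2) (f : Pt → ℂ) (x : Pt) : ℂ := fderiv ℝ f x (ebas i)

/-- Laplacian of a scalar field. -/
def lapl (f : Pt → ℂ) (x : Pt) : ℂ := pd 0 (pd 0 f) x + pd 1 (pd 1 f) x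

/-- Divergence of a vector field. -/
def divg (u : Pt → CV) (x : Pt) : ℂ := pd 0 (fun y => u y 0) x + pd 1 (fun y => u y 1) x

/-- Scalar curl: `curl⃗ u = ∂₂u₁ − ∂₁u₂`. -/
def scurl (u : Pt → CV) (x : Pt) : ℂ := pd 1 (fun y => u y 0) x - pd 0 (fun y => u y 1) x

/-- Vector curl of a scalar field: `curl f = (−∂₂f, ∂₁f)ᵀ`. -/
def vcurl (f : Pt → ℂ) (x : Pt) : CV := fun i => if i = 0 then -(pd 1 f x) else pd 0 f x

/-- The Navier operator `Δ* u = μΔu + (λ+μ)∇(∇·u)`, componentwise. -/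
def navierOp (μ lam : ℝ) (u : Pt → CV) (x : Pt) : CV := fun i =>
  (μ : ℂ) * lapl (fun y => u y i) x + ((lam : ℂ) + (μ : ℂ)) * pd i (divg u) x

/-- The Navier equation `Δ*u + ω²u = 0` on a set `U`. -/
def NavierEqOn (μ lam ω : ℝ) (u : Pt → CV) (U : Set Pt) : Prop :=
  ∀ x ∈ U, ∀ i : Fin 2, navierOp μ lam u x i + ((ω : ℂ)) ^ 2 * u x i = 0

/-- Compressional wavenumber `k_p = ω/√(λ+2μ)`. -/
def kpOf (μ lam ω : ℝ) : ℝ := ω / Real.sqrt (lam + 2 * μ)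

/-- Shear wavenumber `k_s = ω/√μ`. -/
def ksOf (μ ω : ℝ) : ℝ := ω / Real.sqrt μ

/-- Compressional part `u_p = −k_p⁻² grad div u` of a vector field. -/
def compPart (kp : ℝ) (u : Pt → CV) (x : Pt) : CV := fun i =>
  -(1 / ((kp : ℂ)) ^ 2) * pd i (divg u) x

/-- Shear part `u_s = k_s⁻² curl curl⃗ u` of a vector field. -/
def shearPart (ks : ℝ) (u : Pt → CV) (x : Pt) : CV := fun i =>
  (1 / ((ks : ℂ)) ^ 2) * vcurl (scurl u) x i

/-- Radial derivative `∂_r f(x) = ∇f(x)·x̂`. -/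
def radialD (f : Pt → ℂ) (x : Pt) : ℂ := fderiv ℝ f x (fun j => x j / nrm x)

/-- Sommerfeld radiation condition `∂_r w − ikw = o(r^{-1/2})`, uniformly in all directions. -/
def SommerfeldRad (k : ℝ) (w : Pt → ℂ) : Prop :=
  ∀ ε > (0 : ℝ), ∃ R > (0 : ℝ), ∀ x : Pt, R ≤ nrm x →
    Real.sqrt (nrm x) * ‖radialD w x - Complex.I * (k : ℂ) * w x‖ ≤ ε

/-- Kupradze radiation condition for a vector field. -/
def KupradzeRad (kp ks : ℝ) (u : Pt → CV) : Prop :=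
  (∀ i : Fin 2, SommerfeldRad kp (fun x => compPart kp u x i)) ∧
  (∀ i : Fin 2, SommerfeldRad ks (fun x => shearPart ks u x i))

/-- Unit direction with polar angle `θ`. -/
def dirv (θ : ℝ) : Pt := fun i => if i = 0 then Real.cos θ else Real.sin θ

/-- The orthogonal direction `(−sinθ, cosθ)`. -/
def dirp (θ : ℝ) : Pt := fun i => if i = 0 then -Real.sin θ else Real.cos θ

/-- The point with polar coordinates `(r, θ)`. -/
def ptAt (r θ : ℝ) : Pt := fun i => r * dirv θ i

/-- `x · d(θ)`. -/
def dotd (x : Pt) (θ : ℝ) : ℝ := x 0 * Real.cos θ + x 1 * Real.sin θ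

/-- `u` is a field with far-field pattern `fp x̂ + fs x̂^⊥` (p-part `fp`, s-part `fs`). -/
def HasFarField (kp ks : ℝ) (u : Pt → CV) (fp fs : ℝ → ℂ) : Prop :=
  ∃ C > (0 : ℝ), ∃ R0 > (0 : ℝ), ∀ r : ℝ, R0 ≤ r → ∀ θ : ℝ, ∀ i : Fin 2,
    ‖u (ptAt r θ) i
      - Complex.exp (Complex.I * (kp : ℂ) * (r : ℂ)) / ((Real.sqrt r : ℝ) : ℂ) * fp θ * ((dirv θ i : ℝ) : ℂ)
      - Complex.exp (Complex.I * (ks : ℂ) * (r : ℂ)) / ((Real.sqrt r : ℝ) : ℂ) * fs θ * ((dirp θ i : ℝ) : ℂ)‖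
      ≤ C * r ^ (-(3 : ℝ) / 2)

/-- Scalar far-field pattern for the Helmholtz equation. -/
def HasFarFieldScalar (k : ℝ) (w : Pt → ℂ) (f : ℝ → ℂ) : Prop :=
  ∃ C > (0 : ℝ), ∃ R0 > (0 : ℝ), ∀ r : ℝ, R0 ≤ r → ∀ θ : ℝ,
    ‖w (ptAt r θ) - Complex.exp (Complex.I * (k : ℂ) * (r : ℂ)) / ((Real.sqrt r : ℝ) : ℂ) * f θ‖
      ≤ C * r ^ (-(3 : ℝ) / 2)

/-- The elastic plane wave `u^i(x; d, c_p, c_s) = c_p d e^{ik_p x·d} + c_s d^⊥ e^{ik_s x·d}`,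
with incident direction `d = (cos θd, sin θd)`. -/
def planeWave (kp ks θd : ℝ) (cp cs : ℂ) (x : Pt) : CV := fun i =>
  cp * ((dirv θd i : ℝ) : ℂ) * Complex.exp (Complex.I * (kp : ℂ) * ((dotd x θd : ℝ) : ℂ))
  + cs * ((dirp θd i : ℝ) : ℂ) * Complex.exp (Complex.I * (ks : ℂ) * ((dotd x θd : ℝ) : ℂ))

/-- `usc` is the Kupradze radiating scattered field for the incident field `ui`
and the rigid scatterer `Ω` (total field vanishes on `∂Ω`). -/
structure ScatteredBy (μ lam ω : ℝ) (Ω : Set Pt) (ui usc : Pt → CV) : Prop where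
  cont : ∀ i : Fin 2, ContinuousOn (fun x => usc x i) (interior Ω)ᶜ
  navier : NavierEqOn μ lam ω (fun x => ui x + usc x) (closure Ω)ᶜ
  bdry : ∀ x ∈ frontier Ω, ui x + usc x = 0
  rad : KupradzeRad (kpOf μ lam ω) (ksOf μ ω) usc

/-- `(upp, usp, ups, uss)` are the far-field kernels of the rigid scatterer `Ω`:
for every incident direction, the P- and S-parts of the far-field patterns of the
scattered waves for compressional resp. shear plane-wave incidence. -/
def IsFarFieldKernel (μ lam ω : ℝ) (Ω : Set Pt) (upp usp ups uss : ℝ → ℝ → ℂ) : Prop :=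
  ∀ θd : ℝ,
    (∃ v : Pt → CV,
      ScatteredBy μ lam ω Ω (planeWave (kpOf μ lam ω) (ksOf μ ω) θd 1 0) v ∧
      HasFarField (kpOf μ lam ω) (ksOf μ ω) v (fun θx => upp θx θd) (fun θx => usp θx θd)) ∧
    (∃ w : Pt → CV,
      ScatteredBy μ lam ω Ω (planeWave (kpOf μ lam ω) (ksOf μ ω) θd 0 1) w ∧
      HasFarField (kpOf μ lam ω) (ksOf μ ω) w (fun θx => ups θx θd) (fun θx => uss θx θd))

/-- Elements of `(L²(𝕊))²` as pairs (p-part, s-part) of angle-parametrized functions. -/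
abbrev SphPair : Type := (ℝ → ℂ) × (ℝ → ℂ)

/-- `(L²(𝕊))²` inner product. -/
def ip2 (f g : SphPair) : ℂ :=
  ∫ θ in (0:ℝ)..(2 * π), (f.1 θ * (starRingEnd ℂ) (g.1 θ) + f.2 θ * (starRingEnd ℂ) (g.2 θ))

/-- `L²(𝕊)` inner product. -/
def ipS (f g : ℝ → ℂ) : ℂ := ∫ θ in (0:ℝ)..(2 * π), f θ * (starRingEnd ℂ) (g θ)

/-- Membership in `(L²(𝕊))²`. -/
def MemL2Pair (f : SphPair) : Prop :=
  Measurable f.1 ∧ Measurable f.2 ∧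
    IntervalIntegrable (fun θ => ‖f.1 θ‖ ^ 2 + ‖f.2 θ‖ ^ 2) volume 0 (2 * π)

/-- Membership in `L²(𝕊)`. -/
def MemL2S (f : ℝ → ℂ) : Prop :=
  Measurable f ∧ IntervalIntegrable (fun θ => ‖f θ‖ ^ 2) volume 0 (2 * π)

/-- Scalar multiplication on pairs. -/
def smul2 (c : ℂ) (f : SphPair) : SphPair := (fun θ => c * f.1 θ, fun θ => c * f.2 θ)

/-- The elastic far-field operator built from the far-field kernels. -/
def ffOp (ω kp ks : ℝ) (upp usp ups uss : ℝ → ℝ → ℂ) (g : SphPair) : SphPair :=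
  (fun θx => Complex.exp (-(Complex.I * ((π : ℝ) : ℂ) / 4)) *
    ∫ θd in (0:ℝ)..(2 * π),
      (((Real.sqrt (kp / ω) : ℝ) : ℂ) * upp θx θd * g.1 θd
        + ((Real.sqrt (ks / ω) : ℝ) : ℂ) * ups θx θd * g.2 θd),
   fun θx => Complex.exp (-(Complex.I * ((π : ℝ) : ℂ) / 4)) *
    ∫ θd in (0:ℝ)..(2 * π),
      (((Real.sqrt (kp / ω) : ℝ) : ℂ) * usp θx θd * g.1 θd
        + ((Real.sqrt (ks / ω) : ℝ) : ℂ) * uss θx θd * g.2 θd))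

/-- The projected (P- or S-) far-field operator, built from one diagonal kernel. -/
def ffOpProj (ω k : ℝ) (ker : ℝ → ℝ → ℂ) (g : ℝ → ℂ) : ℝ → ℂ := fun θx =>
  Complex.exp (-(Complex.I * ((π : ℝ) : ℂ) / 4)) * ((Real.sqrt (k / ω) : ℝ) : ℂ) *
    ∫ θd in (0:ℝ)..(2 * π), ker θx θd * g θd

/-- A complete orthonormal eigensystem ("spectral system") of an operator on `(L²(𝕊))²`. -/
def SpectralSystem2 (F : SphPair → SphPair) (lv : ℤ → ℂ) (φ : ℤ → SphPair) : Prop :=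
  (∀ n, MemL2Pair (φ n)) ∧
  (∀ n, F (φ n) = smul2 (lv n) (φ n)) ∧
  (∀ n m, ip2 (φ n) (φ m) = if n = m then 1 else 0) ∧
  (∀ f : SphPair, MemL2Pair f → (∀ n, ip2 f (φ n) = 0) →
    (∫ θ in (0:ℝ)..(2 * π), (‖f.1 θ‖ ^ 2 + ‖f.2 θ‖ ^ 2)) = 0)

/-- A complete orthonormal eigensystem of an operator on `L²(𝕊)`. -/
def SpectralSystemS (F : (ℝ → ℂ) → (ℝ → ℂ)) (lv : ℤ → ℂ) (φ : ℤ → ℝ → ℂ) : Prop :=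
  (∀ n, MemL2S (φ n)) ∧
  (∀ n, F (φ n) = fun θ => lv n * φ n θ) ∧
  (∀ n m, ipS (φ n) (φ m) = if n = m then 1 else 0) ∧
  (∀ f : ℝ → ℂ, MemL2S f → (∀ n, ipS f (φ n) = 0) →
    (∫ θ in (0:ℝ)..(2 * π), ‖f θ‖ ^ 2) = 0)

/-- `ev` is a Dirichlet eigenvalue of `−Δ*` on `Ω`. -/
def IsNavierDirichletEigenvalue (μ lam : ℝ) (Ω : Set Pt) (ev : ℝ) : Prop :=
  ∃ u : Pt → CV, (∃ x ∈ Ω, u x ≠ 0) ∧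
    (∀ i : Fin 2, ContinuousOn (fun x => u x i) (closure Ω)) ∧
    (∀ x ∈ Ω, ∀ i : Fin 2, navierOp μ lam u x i + ((ev : ℝ) : ℂ) * u x i = 0) ∧
    (∀ x ∈ frontier Ω, u x = 0)

/-- `v` is `H¹` in an exterior neighborhood of `∂Ω`; by the trace theorem this encodes
that the boundary data `v|_{∂Ω}` lie in `(H^{1/2}(∂Ω))²`. -/
def H1NearBoundary (Ω : Set Pt) (v : Pt → CV) : Prop :=
  ∃ U : Set Pt, IsOpen U ∧ closure Ω ⊆ U ∧
    IntegrableOn (fun x => ‖v x‖ ^ 2 + ‖fderiv ℝ v x‖ ^ 2) (U \ closure Ω) volume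

/-- Helmholtz equation `Δw + k²w = 0` on a set. -/
def HelmholtzEqOn (k : ℝ) (w : Pt → ℂ) (U : Set Pt) : Prop :=
  ∀ x ∈ U, lapl w x + ((k : ℂ)) ^ 2 * w x = 0

/-- `D` is an open convex polygon (interior of the convex hull of finitely many points,
with at least three vertices). -/
def IsConvexPolygon (D : Set Pt) : Prop :=
  ∃ V : Finset Pt, 3 ≤ V.card ∧ D.Nonempty ∧ D = interior (convexHull ℝ (V : Set Pt))

/-- `u` can be analytically extended across the point `O` from `ℝ² \ D̄`, i.e. there is a
solution of the (homogeneous) Navier equation on a full neighborhood of `O` agreeing with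
`u` outside `D̄`. -/
def ExtendsAcross (μ lam ω : ℝ) (D : Set Pt) (u : Pt → CV) (O : Pt) : Prop :=
  ∃ ε > (0 : ℝ), ∃ w : Pt → CV,
    (∀ i : Fin 2, ContinuousOn (fun x => w x i) (Metric.ball O ε)) ∧
    NavierEqOn μ lam ω w (Metric.ball O ε) ∧
    ∀ x ∈ Metric.ball O ε \ closure D, w x = u x

/-- The open disk `B_R` centered at the origin. -/
def ballR (R : ℝ) : Set Pt := {x : Pt | nrm x < R}

/-- The open disk `B_R(z)` centered at `z`. -/
def ballRz (z : Pt) (R : ℝ) : Set Pt := {x : Pt | nrm (fun i => x i - z i) < R}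

/-- Bessel function of integer order (via the Bessel integral representation). -/
def besselJ (n : ℤ) (x : ℝ) : ℂ :=
  (((1 / π) * ∫ τ in (0:ℝ)..π, Real.cos ((n : ℝ) * τ - x * Real.sin τ) : ℝ) : ℂ)

/-- Neumann function of integer order (for positive arguments). -/
def besselY (n : ℤ) (x : ℝ) : ℂ :=
  ((((1 / π) * ∫ τ in (0:ℝ)..π, Real.sin (x * Real.sin τ - (n : ℝ) * τ))
    - (1 / π) * ∫ t in Set.Ioi (0:ℝ),
        (Real.exp ((n : ℝ) * t) + (-1 : ℝ) ^ n * Real.exp (-((n : ℝ) * t))) * Real.exp (-x * Real.sinh t) : ℝ) : ℂ)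

/-- `J_n'`, via the recurrence `2J_n' = J_{n-1} − J_{n+1}`. -/
def besselJd (n : ℤ) (x : ℝ) : ℂ := (besselJ (n - 1) x - besselJ (n + 1) x) / 2

/-- `Y_n'`. -/
def besselYd (n : ℤ) (x : ℝ) : ℂ := (besselY (n - 1) x - besselY (n + 1) x) / 2

/-- Hankel function of the first kind `H_n^{(1)} = J_n + iY_n`. -/
def hankel (n : ℤ) (x : ℝ) : ℂ := besselJ n x + Complex.I * besselY n x

/-- `H_n^{(1)′}`. -/
def hankeld (n : ℤ) (x : ℝ) : ℂ := besselJd n x + Complex.I * besselYd n x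

/-- The matrix `𝒥_n`. -/
def Jmat (tp ts : ℝ) (n : ℤ) : Matrix (Fin 2) (Fin 2) ℂ :=
  !![(tp : ℂ) * besselJd n tp, -(Complex.I * (n : ℂ) * besselJ n ts);
     Complex.I * (n : ℂ) * besselJ n tp, (ts : ℂ) * besselJd n ts]

/-- The matrix `𝒴_n`. -/
def Ymat (tp ts : ℝ) (n : ℤ) : Matrix (Fin 2) (Fin 2) ℂ :=
  !![(tp : ℂ) * besselYd n tp, -(Complex.I * (n : ℂ) * besselY n ts);
     Complex.I * (n : ℂ) * besselY n tp, (ts : ℂ) * besselYd n ts]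

/-- The matrix `ℋ_n`. -/
def Hmat (tp ts : ℝ) (n : ℤ) : Matrix (Fin 2) (Fin 2) ℂ :=
  !![(tp : ℂ) * hankeld n tp, -(Complex.I * (n : ℂ) * hankel n ts);
     Complex.I * (n : ℂ) * hankel n tp, (ts : ℂ) * hankeld n ts]

/-- The matrix `Q = diag(k_p^{-1/2}, k_s^{-1/2})`. -/
def Qmat (kp ks : ℝ) : Matrix (Fin 2) (Fin 2) ℂ :=
  !![((1 / Real.sqrt kp : ℝ) : ℂ), 0; 0, ((1 / Real.sqrt ks : ℝ) : ℂ)]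

/-- The matrix `Σ_n = ℋ_n⁻¹ 𝒥_n`. -/
def SigmaMat (tp ts : ℝ) (n : ℤ) : Matrix (Fin 2) (Fin 2) ℂ := (Hmat tp ts n)⁻¹ * Jmat tp ts n

/-- The quantity `β_n`. -/
def betaN (tp ts : ℝ) (n : ℤ) : ℂ :=
  (((π : ℝ) : ℂ) / (2 * Complex.I * (n : ℂ))) *
    ((n : ℂ) ^ 2 * (besselJ n ts * besselY n tp - besselJ n tp * besselY n ts)
      + (tp : ℂ) * (ts : ℂ) * (besselJd n tp * besselYd n ts - besselJd n ts * besselYd n tp))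

/-- The two roots `σ_1^{(n)}, σ_2^{(n)}` of `σ² + β_n σ + 1 = 0` (indexed by `j : Fin 2`). -/
def sigmaRoot (tp ts : ℝ) (n : ℤ) (j : Fin 2) : ℂ :=
  (-betaN tp ts n + (if j = 0 then 1 else -1) * (betaN tp ts n ^ 2 - 4) ^ ((1 : ℂ) / 2)) / 2

/-- Normalized eigenvector `X_{n,j} = (1, σ_j^{(n)})ᵀ / √(1+|σ_j^{(n)}|²)`. -/
def XnormVec (tp ts : ℝ) (n : ℤ) (j : Fin 2) : Fin 2 → ℂ := fun i =>
  (if i = 0 then 1 else sigmaRoot tp ts n j) / ((Real.sqrt (1 + ‖sigmaRoot tp ts n j‖ ^ 2) : ℝ) : ℂ)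

/-- `e^{inθ}`. -/
def eθ (n : ℤ) (θ : ℝ) : ℂ := Complex.exp (Complex.I * (n : ℂ) * ((θ : ℝ) : ℂ))

/-- Eigenvalues `λ^{(n)}_{B_R,j}` of the far-field operator of the rigid disk. -/
def lamBR (ω tp ts : ℝ) (n : ℤ) (j : Fin 2) : ℂ :=
  ((Real.sqrt (8 * π / ω) : ℝ) : ℂ) *
    (Complex.I * (tp : ℂ) * besselJd n tp - (n : ℂ) * besselJ n ts * sigmaRoot tp ts n j) /
    ((tp : ℂ) * hankeld n tp + Complex.I * (n : ℂ) * hankel n ts * sigmaRoot tp ts n j)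

/-- Eigenfunctions `X^{(n)}_{B_R,j}` of the far-field operator of the centered rigid disk,
as pairs (p-part, s-part). -/
def XBR (kp ks tp ts : ℝ) (n : ℤ) (j : Fin 2) : SphPair :=
  (fun θ => ((Real.sqrt kp : ℝ) : ℂ) * eθ n θ / ((Real.sqrt (1 + ‖sigmaRoot tp ts n j‖ ^ 2) : ℝ) : ℂ),
   fun θ => ((Real.sqrt ks : ℝ) : ℂ) * sigmaRoot tp ts n j * eθ n θ /
     ((Real.sqrt (1 + ‖sigmaRoot tp ts n j‖ ^ 2) : ℝ) : ℂ))

/-- Eigenfunctions `X^{(n)}_{B_R(z),j}` for the translated disk. -/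
def XBRz (kp ks tp ts : ℝ) (z : Pt) (n : ℤ) (j : Fin 2) : SphPair :=
  (fun θ => ((Real.sqrt kp : ℝ) : ℂ) * Complex.exp (-(Complex.I * (kp : ℂ) * ((dotd z θ : ℝ) : ℂ)))
      * eθ n θ / ((Real.sqrt (1 + ‖sigmaRoot tp ts n j‖ ^ 2) : ℝ) : ℂ),
   fun θ => ((Real.sqrt ks : ℝ) : ℂ) * sigmaRoot tp ts n j
      * Complex.exp (-(Complex.I * (ks : ℂ) * ((dotd z θ : ℝ) : ℂ)))
      * eθ n θ / ((Real.sqrt (1 + ‖sigmaRoot tp ts n j‖ ^ 2) : ℝ) : ℂ))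

/-- Eigenvalues `η^{(n)}_{B_R,α}` of the projected far-field operators of the rigid disk;
`entry = 0` for P, `entry = 1` for S. -/
def etaProj (k tp ts : ℝ) (entry : Fin 2) (n : ℤ) : ℂ :=
  ((Real.sqrt (2 / (π * k)) : ℝ) : ℂ) * Complex.exp (Complex.I * ((π : ℝ) : ℂ) / 4) * Complex.I *
    SigmaMat tp ts n entry entry

/-- Fourier coefficients of `w` restricted to the circle of radius `R`. -/
def circCoef (R : ℝ) (w : Pt → ℂ) (n : ℤ) : ℂ :=
  (1 / (2 * ((π : ℝ) : ℂ))) *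
    ∫ θ in (0:ℝ)..(2 * π), w (ptAt R θ) * Complex.exp (-(Complex.I * (n : ℂ) * ((θ : ℝ) : ℂ)))

/-- Labels for the compressional (p) and shear (s) parts. -/
inductive PS | p | s

/-- Pick `a` in the p-case and `b` in the s-case. -/
def PS.pick {X : Sort*} (α : PS) (a b : X) : X := match α with | PS.p => a | PS.s => b

/-- `α`-wavenumber. -/
def PS.wavenum (α : PS) (kp ks : ℝ) : ℝ := α.pick kp ks

/-- The scalar Hodge component: `−k_p⁻² div v` in the p-case,
`k_s⁻² curl⃗ v` in the s-case. -/
def hodgeScalar (kp ks : ℝ) (α : PS) (v : Pt → CV) : Pt → ℂ :=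
  α.pick (fun x => -(1 / ((kp : ℂ)) ^ 2) * divg v x) (fun x => (1 / ((ks : ℂ)) ^ 2) * scurl v x)

open Set Filter Topology Asymptotics
open scoped Nat

/-- The real value of the Bessel function `J_n`. -/
def realBesselJ (n : ℤ) (x : ℝ) : ℝ :=
  (1 / π) * ∫ τ in (0:ℝ)..π, Real.cos ((n : ℝ) * τ - x * Real.sin τ)

lemma integral_cos_int_mul (m : ℤ) :
    ∫ τ in (0:ℝ)..π, Real.cos ((m : ℝ) * τ) = if m = 0 then π else 0 := by
  split_ifs with h
  · simp [h]
  · have hm : (m : ℝ) ≠ 0 := by exact_mod_cast h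
    rw [intervalIntegral.integral_comp_mul_left _ hm]
    simp [Real.sin_int_mul_pi]

lemma hasSum_mul_of_summable_norm {f g : ℕ → ℂ} {a b : ℂ} (hf : HasSum f a) (hg : HasSum g b)
    (hf' : Summable fun k => ‖f k‖) (hg' : Summable fun k => ‖g k‖) :
    HasSum (fun p : ℕ × ℕ => f p.1 * g p.2) (a * b) :=
  hf.mul hg (summable_mul_of_summable_norm hf' hg')

lemma summable_norm_pow_div_factorial (w : ℂ) : Summable fun k : ℕ => ‖w ^ k / (k ! : ℂ)‖ :=
  NormedSpace.norm_expSeries_div_summable w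

lemma hasSum_pow_div_factorial_mul {w v a b : ℂ}
    (hw : HasSum (fun k : ℕ => w ^ k / (k ! : ℂ)) a)
    (hv : HasSum (fun k : ℕ => v ^ k / (k ! : ℂ)) b) :
    HasSum (fun p : ℕ × ℕ => w ^ p.1 / (p.1 ! : ℂ) * (v ^ p.2 / (p.2 ! : ℂ))) (a * b) := by
  have hw' := summable_norm_pow_div_factorial w
  have hv' := summable_norm_pow_div_factorial v
  generalize hf : (fun k : ℕ => w ^ k / (k ! : ℂ)) = f at *
  generalize hg : (fun k : ℕ => v ^ k / (k ! : ℂ)) = g at *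
  have hf1 (k : ℕ) : w ^ k / (k ! : ℂ) = f k := congrFun hf k
  have hg1 (k : ℕ) : v ^ k / (k ! : ℂ) = g k := congrFun hg k
  simp only [hf1, hg1] at hw' hv' ⊢
  exact hasSum_mul_of_summable_norm hw hv hw' hv'

lemma hasSum_complex_exp (w : ℂ) : HasSum (fun k : ℕ => w ^ k / (k ! : ℂ)) (Complex.exp w) := by
  rw [Complex.exp_eq_exp_ℂ]
  exact NormedSpace.expSeries_div_hasSum_exp w

lemma hasSum_exp_mul_exp (w v : ℂ) :
    HasSum (fun p : ℕ × ℕ => w ^ p.1 / (p.1 ! : ℂ) * (v ^ p.2 / (p.2 ! : ℂ)))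
      (Complex.exp w * Complex.exp v) :=
  hasSum_pow_div_factorial_mul (hasSum_complex_exp w) (hasSum_complex_exp v)

lemma hasSum_cos_sub_mul_sin (n : ℤ) (x τ : ℝ) :
    HasSum (fun p : ℕ × ℕ => (x / 2) ^ p.1 / p.1! * ((-(x / 2)) ^ p.2 / p.2!) *
      Real.cos (((p.1 - p.2 - n : ℤ) : ℝ) * τ)) (Real.cos (n * τ - x * Real.sin τ)) := by
  set z : ℂ := Complex.exp (τ * Complex.I) with hz
  have h := hasSum_exp_mul_exp (((x / 2 : ℝ) : ℂ) * z) (-((x / 2 : ℝ) : ℂ) * z⁻¹)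
  have hz0 : z ≠ 0 := Complex.exp_ne_zero _
  have hpow : ∀ m : ℤ, z ^ m = Complex.exp (((m : ℝ) * τ : ℝ) * Complex.I) := by
    intro m
    rw [hz, ← Complex.exp_int_mul]
    congr 1
    push_cast
    ring
  have hval : (z ^ (-n) * (Complex.exp (((x / 2 : ℝ) : ℂ) * z) *
      Complex.exp (-((x / 2 : ℝ) : ℂ) * z⁻¹))).re = Real.cos (n * τ - x * Real.sin τ) := by
    rw [← Complex.exp_add, hpow, ← Complex.exp_add]
    have hs : ((x / 2 : ℝ) : ℂ) * z + -((x / 2 : ℝ) : ℂ) * z⁻¹ =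
        ((x * Real.sin τ : ℝ) : ℂ) * Complex.I := by
      rw [hz, ← Complex.exp_neg, ← neg_mul, Complex.exp_mul_I, Complex.exp_mul_I, Complex.cos_neg,
        Complex.sin_neg]
      push_cast
      ring
    rw [hs, ← add_mul, ← Complex.ofReal_add, Complex.exp_ofReal_mul_I_re, ← Real.cos_neg]
    congr 1
    push_cast
    ring
  rw [← hval]
  refine (Complex.hasSum_re (h.mul_left (z ^ (-n)))).congr_fun fun p => ?_
  have hterm : z ^ (-n) * ((((x / 2 : ℝ) : ℂ) * z) ^ p.1 / (p.1! : ℂ) *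
      ((-((x / 2 : ℝ) : ℂ) * z⁻¹) ^ p.2 / (p.2! : ℂ))) =
      (((x / 2) ^ p.1 / p.1! * ((-(x / 2)) ^ p.2 / p.2!) : ℝ) : ℂ) *
        z ^ (p.1 - p.2 - n : ℤ) := by
    rw [zpow_sub₀ hz0, zpow_sub₀ hz0, mul_pow, mul_pow, zpow_neg]
    push_cast
    simp only [zpow_natCast, inv_pow]
    ring
  rw [hterm, hpow, Complex.re_ofReal_mul, Complex.exp_ofReal_mul_I_re]

lemma hasSum_realBesselJ (n : ℕ) (x : ℝ) :
    HasSum (fun k : ℕ => (x / 2) ^ (n + k) / (n + k)! * ((-(x / 2)) ^ k / k !))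
      (realBesselJ n x) := by
  set b : ℕ × ℕ → ℝ := fun p => (x / 2) ^ p.1 / p.1! * ((-(x / 2)) ^ p.2 / p.2!) with hb
  have hbs : Summable fun p => ‖b p‖ := by
    exact (summable_mul_of_summable_norm (f := fun k : ℕ => (x / 2) ^ k / (k ! : ℝ))
      (g := fun k : ℕ => (-(x / 2)) ^ k / (k ! : ℝ)) (Real.summable_pow_div_factorial _).norm
      (Real.summable_pow_div_factorial _).norm).norm
  have h := intervalIntegral.hasSum_integral_of_dominated_convergence (a := 0) (b := π)
    (μ := volume) (F := fun p τ => b p * Real.cos (((p.1 - p.2 - (n : ℤ) : ℤ) : ℝ) * τ))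
    (f := fun τ => Real.cos (((n : ℤ) : ℝ) * τ - x * Real.sin τ)) (fun p _ => ‖b p‖)
    (fun p => by fun_prop)
    (fun p => .of_forall fun τ _ => by
      rw [norm_mul]
      exact mul_le_of_le_one_right (norm_nonneg _) (Real.abs_cos_le_one _))
    (.of_forall fun _ _ => hbs) (by simp)
    (.of_forall fun τ _ => hasSum_cos_sub_mul_sin n x τ)
  have hcoef (p : ℕ × ℕ) : (1 / π) * ∫ τ in (0:ℝ)..π,
      b p * Real.cos (((p.1 - p.2 - (n : ℤ) : ℤ) : ℝ) * τ) = if p.1 = n + p.2 then b p else 0 := by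
    rw [intervalIntegral.integral_const_mul, integral_cos_int_mul]
    have hiff : (p.1 - p.2 - (n : ℤ) : ℤ) = 0 ↔ p.1 = n + p.2 := by omega
    simp only [hiff]
    split_ifs
    · field_simp
    · simp
  have h' : HasSum (fun p : ℕ × ℕ => if p.1 = n + p.2 then b p else 0) (realBesselJ n x) :=
    (h.mul_left (1 / π)).congr_fun fun p => (hcoef p).symm
  have hinj : Function.Injective fun k : ℕ => (n + k, k) := fun a b hab => (Prod.ext_iff.1 hab).2
  refine ((hinj.hasSum_iff fun p hp => if_neg fun hpn => hp ⟨p.2, ?_⟩).2 h').congr_fun fun k => ?_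
  · exact Prod.ext hpn.symm rfl
  · simp [hb]

lemma abs_realBesselJ_normalized_sub_one_le {n : ℕ} (hn : 1 ≤ n) {x : ℝ} (hx : 0 < x) :
    |realBesselJ n x * n ! / (x / 2) ^ n - 1| ≤
      (x / 2) ^ 2 * Real.exp ((x / 2) ^ 2) * (n : ℝ)⁻¹ := by
  set y := x / 2 with hy
  have hy0 : 0 < y := by positivity
  have hs : HasSum (fun k : ℕ => (y ^ k * n ! / (n + k)!) * ((-y) ^ k / k !))
      (realBesselJ n x * n ! / y ^ n) := by
    rw [mul_div_assoc]
    refine ((hasSum_realBesselJ n x).mul_right ((n ! : ℝ) / y ^ n)).congr_fun fun k => ?_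
    rw [← hy, pow_add]
    field_simp
  have hs1 := (hasSum_nat_add_iff' 1).2 hs
  simp only [Finset.range_one, Finset.sum_singleton, pow_zero, Nat.factorial_zero, add_zero,
    Nat.cast_one, one_mul, div_one, mul_one] at hs1
  rw [div_self (by positivity)] at hs1
  rw [← hs1.tsum_eq, ← Real.norm_eq_abs]
  have hexp : HasSum (fun k : ℕ => y ^ 2 * (n : ℝ)⁻¹ * ((y ^ 2) ^ k / k !))
      (y ^ 2 * (n : ℝ)⁻¹ * Real.exp (y ^ 2)) := by
    rw [Real.exp_eq_exp_ℝ]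
    exact (NormedSpace.expSeries_div_hasSum_exp (y ^ 2)).mul_left _
  refine (tsum_of_norm_bounded hexp fun k => ?_).trans_eq (by ring)
  rw [norm_mul, norm_div, norm_div, norm_pow, norm_neg, Real.norm_of_nonneg hy0.le,
    Real.norm_of_nonneg (by positivity : 0 ≤ y ^ (k + 1) * (n ! : ℝ)), RCLike.norm_natCast,
    RCLike.norm_natCast]
  have hn0 : (0 : ℝ) < n := by exact_mod_cast hn
  have h1 : (n : ℝ) * n ! ≤ (n + (k + 1))! := by
    have : (n + 1)! ≤ (n + (k + 1))! := Nat.factorial_le (by omega)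
    rw [Nat.factorial_succ] at this
    exact_mod_cast (Nat.mul_le_mul_right _ (Nat.le_succ n)).trans this
  have h2 : (k ! : ℝ) ≤ (k + 1)! := by exact_mod_cast Nat.factorial_le (Nat.le_succ k)
  calc y ^ (k + 1) * n ! / (n + (k + 1))! * (y ^ (k + 1) / (k + 1)!)
      ≤ y ^ (k + 1) * n ! / (n * n !) * (y ^ (k + 1) / k !) := by gcongr
    _ = _ := by field_simp; ring_nf

/-- The real value of the Neumann function `Y_n`. -/
def realBesselY (n : ℤ) (x : ℝ) : ℝ :=
  (1 / π) * (∫ τ in (0:ℝ)..π, Real.sin (x * Real.sin τ - (n : ℝ) * τ))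
    - (1 / π) * ∫ t in Set.Ioi (0:ℝ),
        (Real.exp ((n : ℝ) * t) + (-1 : ℝ) ^ n * Real.exp (-((n : ℝ) * t))) *
          Real.exp (-x * Real.sinh t)

lemma integral_neumann_eq (n : ℕ) (x : ℝ) :
    ∫ t in Ioi (0:ℝ), (Real.exp (n * t) + (-1 : ℝ) ^ n * Real.exp (-(n * t))) *
      Real.exp (-x * Real.sinh t) =
    ∫ u in Ioi (1:ℝ), u⁻¹ * ((u ^ n + (-1) ^ n * (u ^ n)⁻¹) * Real.exp (-(x / 2) * (u - u⁻¹))) := by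
  have himg : Real.exp '' Ioi 0 = Ioi 1 := by
    ext u
    constructor
    · rintro ⟨t, ht, rfl⟩
      exact Real.one_lt_exp_iff.2 ht
    · intro hu
      exact ⟨Real.log u, Real.log_pos hu, Real.exp_log (zero_lt_one.trans hu)⟩
  rw [← himg, integral_image_eq_integral_abs_deriv_smul measurableSet_Ioi
    (fun t _ => (Real.hasDerivAt_exp t).hasDerivWithinAt) Real.exp_injective.injOn]
  refine setIntegral_congr_fun measurableSet_Ioi fun t _ => ?_
  simp only [abs_of_pos (Real.exp_pos t), smul_eq_mul]
  rw [mul_inv_cancel_left₀ (Real.exp_pos t).ne', Real.exp_neg, Real.exp_nat_mul, Real.sinh_eq,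
    Real.exp_neg]
  congr 2
  ring

lemma integral_pow_mul_exp_neg_mul_Ioi (m : ℕ) {y : ℝ} (hy : 0 < y) :
    ∫ u in Ioi (0:ℝ), u ^ m * Real.exp (-(y * u)) = m ! / y ^ (m + 1) := by
  have h := Real.integral_rpow_mul_exp_neg_mul_Ioi (a := m + 1) (by positivity) hy
  rw [Real.Gamma_nat_eq_factorial] at h
  simp only [add_sub_cancel_right, Real.rpow_natCast] at h
  rw [h]
  norm_cast
  rw [one_div, inv_pow]
  ring

lemma integrableOn_pow_mul_exp_neg_mul_Ioi (m : ℕ) {y : ℝ} (hy : 0 < y) :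
    IntegrableOn (fun u : ℝ => u ^ m * Real.exp (-(y * u))) (Ioi 0) := by
  have h := integrableOn_rpow_mul_exp_neg_mul_rpow (p := 1) (s := m) (b := y)
    (by linarith [(Nat.cast_nonneg m : (0 : ℝ) ≤ m)]) one_pos hy
  simpa using h

lemma abs_neumann_integrand_sub_le (m : ℕ) {y u : ℝ} (hy : 0 < y) (hu : 1 < u) :
    |u⁻¹ * ((u ^ (m + 2) + (-1) ^ (m + 2) * (u ^ (m + 2))⁻¹) * Real.exp (-y * (u - u⁻¹))) -
      u ^ (m + 1) * Real.exp (-(y * u))| ≤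
      ((y + 1) * Real.exp y + 1) * (u ^ m * Real.exp (-(y * u))) := by
  have hu0 : 0 < u := by linarith
  have hui : u⁻¹ ≤ 1 := inv_le_one_of_one_le₀ hu.le
  have hyu : y * u⁻¹ ≤ y := mul_le_of_le_one_right hy.le hui
  have hexp : Real.exp (-y * (u - u⁻¹)) = Real.exp (-(y * u)) * Real.exp (y * u⁻¹) := by
    rw [← Real.exp_add]
    congr 1
    ring
  have hE : Real.exp (y * u⁻¹) ≤ Real.exp y := Real.exp_le_exp.2 hyu
  have hE1 : 0 ≤ Real.exp (y * u⁻¹) - 1 := by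
    linarith [Real.add_one_le_exp (y * u⁻¹), mul_pos hy (inv_pos.2 hu0)]
  have hE2 : Real.exp (y * u⁻¹) - 1 ≤ y * u⁻¹ * Real.exp y := by
    have h1 := Real.add_one_le_exp (-(y * u⁻¹))
    have h2 : Real.exp (-(y * u⁻¹)) * Real.exp (y * u⁻¹) = 1 := by
      rw [← Real.exp_add, neg_add_cancel, Real.exp_zero]
    have h3 : Real.exp (y * u⁻¹) - 1 ≤ y * u⁻¹ * Real.exp (y * u⁻¹) := by
      nlinarith [Real.exp_pos (y * u⁻¹)]
    exact h3.trans (mul_le_mul_of_nonneg_left hE (by positivity))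
  have hpow : u⁻¹ * (u ^ (m + 2))⁻¹ ≤ u ^ m :=
    (mul_le_one₀ hui (by positivity) (inv_le_one_of_one_le₀ (one_le_pow₀ hu.le))).trans
      (one_le_pow₀ hu.le)
  have heq : u⁻¹ * ((u ^ (m + 2) + (-1) ^ (m + 2) * (u ^ (m + 2))⁻¹) *
      Real.exp (-y * (u - u⁻¹))) - u ^ (m + 1) * Real.exp (-(y * u)) =
      Real.exp (-(y * u)) * (u ^ (m + 1) * (Real.exp (y * u⁻¹) - 1) +
        (-1) ^ (m + 2) * (u⁻¹ * (u ^ (m + 2))⁻¹ * Real.exp (y * u⁻¹))) := by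
    rw [hexp, pow_succ u (m + 1)]
    field_simp
    ring
  rw [heq, abs_mul, abs_of_pos (Real.exp_pos _)]
  have h1 : |u ^ (m + 1) * (Real.exp (y * u⁻¹) - 1)| ≤ u ^ m * (y * Real.exp y) := by
    rw [abs_of_nonneg (by positivity)]
    calc u ^ (m + 1) * (Real.exp (y * u⁻¹) - 1) ≤ u ^ (m + 1) * (y * u⁻¹ * Real.exp y) := by gcongr
      _ = u ^ m * (y * Real.exp y) := by rw [pow_succ]; field_simp
  have h2 : |(-1 : ℝ) ^ (m + 2) * (u⁻¹ * (u ^ (m + 2))⁻¹ * Real.exp (y * u⁻¹))| ≤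
      u ^ m * Real.exp y := by
    rw [abs_mul, abs_pow, abs_neg, abs_one, one_pow, one_mul, abs_of_nonneg (by positivity)]
    gcongr
  have h3 : 0 ≤ u ^ m := by positivity
  calc Real.exp (-(y * u)) * |_ + _|
      ≤ Real.exp (-(y * u)) * (u ^ m * (y * Real.exp y) + u ^ m * Real.exp y) := by
        gcongr
        exact (abs_add_le _ _).trans (add_le_add h1 h2)
    _ ≤ _ := by
        have : 0 ≤ u ^ m * Real.exp (-(y * u)) := by positivity
        linarith

lemma abs_integral_neumann_sub_le (m : ℕ) {x : ℝ} (hx : 0 < x) :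
    |(∫ t in Ioi (0:ℝ), (Real.exp (((m + 2 : ℕ) : ℝ) * t) +
        (-1 : ℝ) ^ (m + 2) * Real.exp (-(((m + 2 : ℕ) : ℝ) * t))) * Real.exp (-x * Real.sinh t)) -
      (m + 1)! / (x / 2) ^ (m + 2)| ≤
      ((x / 2 + 1) * Real.exp (x / 2) + 1) * (m ! / (x / 2) ^ (m + 1)) := by
  rw [integral_neumann_eq]
  set y := x / 2 with hy
  have hy0 : 0 < y := by positivity
  set g : ℝ → ℝ := fun u => u⁻¹ * ((u ^ (m + 2) + (-1) ^ (m + 2) * (u ^ (m + 2))⁻¹) *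
    Real.exp (-y * (u - u⁻¹))) with hg
  set K := (y + 1) * Real.exp y + 1 with hK
  have hK1 : 1 ≤ K := by simp only [hK, le_add_iff_nonneg_left]; positivity
  have hI : ∫ u in Ioi 1, g u = ∫ u in Ioi 0, (Ioi 1).indicator g u := by
    rw [setIntegral_indicator measurableSet_Ioi]
    congr 2
    ext u
    simp only [mem_inter_iff, mem_Ioi]
    exact ⟨fun h => ⟨zero_lt_one.trans h, h⟩, fun h => h.2⟩
  have hmain := integrableOn_pow_mul_exp_neg_mul_Ioi (m + 1) hy0
  have hbd := (integrableOn_pow_mul_exp_neg_mul_Ioi m hy0).const_mul K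
  have hgm : Measurable g := by fun_prop
  have hle : ∀ u ∈ Ioi (0 : ℝ), ‖(Ioi 1).indicator g u - u ^ (m + 1) * Real.exp (-(y * u))‖ ≤
      K * (u ^ m * Real.exp (-(y * u))) := by
    intro u hu
    rw [mem_Ioi] at hu
    by_cases h1 : 1 < u
    · rw [indicator_of_mem (mem_Ioi.2 h1)]
      exact abs_neumann_integrand_sub_le m hy0 h1
    · rw [indicator_of_notMem (by simpa using h1), zero_sub, norm_neg,
        Real.norm_of_nonneg (by positivity)]
      push Not at h1
      calc u ^ (m + 1) * Real.exp (-(y * u)) ≤ 1 * (u ^ m * Real.exp (-(y * u))) := by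
            rw [one_mul]
            gcongr ?_ * _
            exact pow_le_pow_of_le_one hu.le h1 (Nat.le_succ m)
        _ ≤ K * (u ^ m * Real.exp (-(y * u))) := by gcongr
  have hae := (ae_restrict_iff' (μ := volume) measurableSet_Ioi).2 (.of_forall hle)
  have hdiff : IntegrableOn
      (fun u => (Ioi 1).indicator g u - u ^ (m + 1) * Real.exp (-(y * u))) (Ioi 0) :=
    hbd.mono' ((hgm.indicator measurableSet_Ioi).sub (by fun_prop)).aestronglyMeasurable hae
  have hind : IntegrableOn ((Ioi 1).indicator g) (Ioi 0) := by
    refine (hdiff.add hmain).congr (.of_forall fun u => ?_)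
    simp
  rw [hI, ← integral_pow_mul_exp_neg_mul_Ioi (m + 1) hy0, ← integral_sub hind hmain,
    ← integral_pow_mul_exp_neg_mul_Ioi m hy0, ← integral_const_mul]
  exact norm_integral_le_of_norm_le hbd hae

lemma abs_realBesselY_normalized_add_one_le (m : ℕ) {x : ℝ} (hx : 0 < x) :
    |realBesselY ((m + 2 : ℕ) : ℤ) x * π * (x / 2) ^ (m + 2) / (m + 1)! + 1| ≤
      (π * (x / 2) ^ 2 * Real.exp (x / 2) +
        ((x / 2 + 1) * Real.exp (x / 2) + 1) * (x / 2)) / (m + 1) := by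
  have hN := abs_integral_neumann_sub_le m hx
  have hA : |(1 / π) * ∫ τ in (0:ℝ)..π,
      Real.sin (x * Real.sin τ - (((m + 2 : ℕ) : ℤ) : ℝ) * τ)| ≤ 1 := by
    have h := intervalIntegral.norm_integral_le_of_norm_le_const (a := 0) (b := π) (C := 1)
      (f := fun τ => Real.sin (x * Real.sin τ - (((m + 2 : ℕ) : ℤ) : ℝ) * τ))
      fun τ _ => Real.abs_sin_le_one _
    rw [Real.norm_eq_abs, sub_zero, abs_of_pos Real.pi_pos, one_mul] at h
    rw [abs_mul, abs_of_pos (by positivity), one_div, inv_mul_le_iff₀ Real.pi_pos, mul_one]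
    exact h
  unfold realBesselY
  simp only [Int.cast_natCast, zpow_natCast] at hA ⊢
  set A := (1 / π) * ∫ τ in (0:ℝ)..π, Real.sin (x * Real.sin τ - ((m + 2 : ℕ) : ℝ) * τ)
  set I := ∫ t in Ioi (0:ℝ), (Real.exp (((m + 2 : ℕ) : ℝ) * t) +
        (-1 : ℝ) ^ (m + 2) * Real.exp (-(((m + 2 : ℕ) : ℝ) * t))) * Real.exp (-x * Real.sinh t)
  set y := x / 2
  have hy0 : 0 < y := by positivity
  set K := (y + 1) * Real.exp y + 1
  have hfac : ((m + 1)! : ℝ) = (m + 1) * m ! := by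
    rw [Nat.factorial_succ]
    push_cast
    ring
  have hm1 : (0 : ℝ) < m + 1 := by positivity
  have heq : (A - 1 / π * I) * π * y ^ (m + 2) / (m + 1)! + 1 =
      A * (π * y ^ (m + 2) / (m + 1)!) -
        (I - (m + 1)! / y ^ (m + 2)) * (y ^ (m + 2) / (m + 1)!) := by
    field_simp
    ring
  have h1 : |A * (π * y ^ (m + 2) / (m + 1)!)| ≤ π * y ^ 2 * Real.exp y / (m + 1) := by
    rw [abs_mul, abs_of_pos (by positivity : 0 < π * y ^ (m + 2) / (m + 1)!)]
    calc |A| * (π * y ^ (m + 2) / (m + 1)!) ≤ 1 * (π * y ^ (m + 2) / (m + 1)!) := by gcongr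
      _ = π * y ^ 2 * (y ^ m / m !) / (m + 1) := by
        rw [hfac, pow_add]
        field_simp
      _ ≤ _ := by
        gcongr
        exact Real.pow_div_factorial_le_exp y hy0.le m
  have h2 : |(I - (m + 1)! / y ^ (m + 2)) * (y ^ (m + 2) / (m + 1)!)| ≤ K * y / (m + 1) := by
    rw [abs_mul, abs_of_pos (by positivity : 0 < y ^ (m + 2) / ((m + 1)! : ℝ))]
    calc _ ≤ K * (m ! / y ^ (m + 1)) * (y ^ (m + 2) / (m + 1)!) := by gcongr
      _ = _ := by
        rw [hfac, pow_succ y (m + 1)]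
        field_simp
  rw [heq, add_div]
  exact (abs_sub _ _).trans (add_le_add h1 h2)

/-- `f = 1 + O(1/n)` as `n → ∞`. -/
def TendsToOneRate (f : ℕ → ℝ) : Prop :=
  (fun n => f n - 1) =O[atTop] fun n : ℕ => (n : ℝ)⁻¹

lemma isBigO_inv_natCast_one : (fun n : ℕ => (n : ℝ)⁻¹) =O[atTop] fun _ => (1 : ℝ) :=
  tendsto_inv_atTop_nhds_zero_nat.isBigO_one ℝ

lemma isBigO_inv_natCast_add_one :
    (fun n : ℕ => ((n + 1 : ℕ) : ℝ)⁻¹) =O[atTop] fun n : ℕ => (n : ℝ)⁻¹ := by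
  refine .of_bound 1 ((eventually_ge_atTop 1).mono fun n hn => ?_)
  have : (0 : ℝ) < n := by exact_mod_cast hn
  rw [one_mul, norm_inv, norm_inv, RCLike.norm_natCast, RCLike.norm_natCast]
  gcongr
  omega

lemma isBigO_inv_natCast_sub_one :
    (fun n : ℕ => ((n - 1 : ℕ) : ℝ)⁻¹) =O[atTop] fun n : ℕ => (n : ℝ)⁻¹ := by
  refine .of_bound 2 ((eventually_ge_atTop 2).mono fun n hn => ?_)
  obtain ⟨m, rfl⟩ := Nat.exists_eq_add_of_le' hn
  simp only [Nat.add_succ_sub_one, norm_inv, RCLike.norm_natCast]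
  push_cast
  rw [← div_eq_mul_inv, inv_eq_one_div, div_le_div_iff₀ (by positivity) (by positivity)]
  linarith [(Nat.cast_nonneg m : (0 : ℝ) ≤ m)]

namespace TendsToOneRate

variable {f g : ℕ → ℝ}

lemma isBigO_one (hf : TendsToOneRate f) : f =O[atTop] fun _ => (1 : ℝ) := by
  have h := (hf.trans isBigO_inv_natCast_one).add (isBigO_refl (fun _ : ℕ => (1 : ℝ)) atTop)
  simpa using h

lemma mul (hf : TendsToOneRate f) (hg : TendsToOneRate g) :
    TendsToOneRate fun n => f n * g n := by
  have h := (hf.isBigO_one.mul hg).congr_right (g₂ := fun n : ℕ => (n : ℝ)⁻¹) fun n => one_mul _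
  exact (h.add hf).congr_left fun n => by ring

lemma average (hf : TendsToOneRate f) (hg : TendsToOneRate g) :
    TendsToOneRate fun n => (f n + g n) / 2 :=
  ((hf.add hg).const_mul_left (1 / 2)).congr_left fun n => by ring

lemma sub_of_isBigO (hf : TendsToOneRate f) (hg : g =O[atTop] fun n : ℕ => (n : ℝ)⁻¹) :
    TendsToOneRate fun n => f n - g n :=
  (hf.sub hg).congr_left fun n => by ring

lemma comp_add_one (hf : TendsToOneRate f) : TendsToOneRate fun n => f (n + 1) :=
  (hf.comp_tendsto (tendsto_add_atTop_nat 1)).trans isBigO_inv_natCast_add_one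

lemma comp_sub_one (hf : TendsToOneRate f) : TendsToOneRate fun n => f (n - 1) :=
  (hf.comp_tendsto (tendsto_sub_atTop_nat 1)).trans isBigO_inv_natCast_sub_one

lemma congr' (hf : TendsToOneRate f) (h : ∀ᶠ n in atTop, f n = g n) : TendsToOneRate g :=
  IsBigO.congr' hf (h.mono fun n hn => by simp only [hn]) .rfl

end TendsToOneRate

lemma tendsToOneRate_besselJ {x : ℝ} (hx : 0 < x) :
    TendsToOneRate fun n => realBesselJ n x * n ! / (x / 2) ^ n := by
  refine .of_bound ((x / 2) ^ 2 * Real.exp ((x / 2) ^ 2))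
    ((eventually_ge_atTop 1).mono fun n hn => ?_)
  rw [norm_inv, RCLike.norm_natCast]
  exact abs_realBesselJ_normalized_sub_one_le hn hx

lemma tendsToOneRate_besselY {x : ℝ} (hx : 0 < x) :
    TendsToOneRate fun n => -realBesselY n x * π * (x / 2) ^ n / (n - 1)! := by
  set C := π * (x / 2) ^ 2 * Real.exp (x / 2) + ((x / 2 + 1) * Real.exp (x / 2) + 1) * (x / 2)
    with hC
  refine IsBigO.trans (.of_bound C ((eventually_ge_atTop 2).mono fun n hn => ?_))
    isBigO_inv_natCast_sub_one
  obtain ⟨m, rfl⟩ := Nat.exists_eq_add_of_le' hn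
  have h := abs_realBesselY_normalized_add_one_le m hx
  rw [← hC] at h
  simp only [Nat.add_succ_sub_one, norm_inv, RCLike.norm_natCast]
  rw [← div_eq_mul_inv, Real.norm_eq_abs, ← abs_neg]
  push_cast at h ⊢
  convert h using 2
  ring

/-- The real value of `J_n'`. -/
def realBesselJd (n : ℤ) (x : ℝ) : ℝ := (realBesselJ (n - 1) x - realBesselJ (n + 1) x) / 2

/-- The real value of `Y_n'`. -/
def realBesselYd (n : ℤ) (x : ℝ) : ℝ := (realBesselY (n - 1) x - realBesselY (n + 1) x) / 2

lemma tendsToOneRate_besselJd {x : ℝ} (hx : 0 < x) :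
    TendsToOneRate fun n => realBesselJd n x * 2 * (n - 1)! / (x / 2) ^ (n - 1) := by
  have hJ := tendsToOneRate_besselJ hx
  have hsmall : (fun n : ℕ => realBesselJ (n + 1 : ℕ) x * (n + 1)! / (x / 2) ^ (n + 1) *
      ((x / 2) ^ 2 * (((n + 1 : ℕ) : ℝ)⁻¹ * (n : ℝ)⁻¹))) =O[atTop] fun n : ℕ => (n : ℝ)⁻¹ := by
    have h := hJ.comp_add_one.isBigO_one.mul (((isBigO_inv_natCast_add_one.trans
      isBigO_inv_natCast_one).mul (isBigO_refl (fun n : ℕ => (n : ℝ)⁻¹) atTop)).const_mul_left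
      ((x / 2) ^ 2))
    simpa using h
  refine (hJ.comp_sub_one.sub_of_isBigO hsmall).congr' ((eventually_ge_atTop 1).mono fun n hn => ?_)
  obtain ⟨m, rfl⟩ := Nat.exists_eq_add_of_le' hn
  have h1 : (((m + 1 : ℕ) : ℤ) - 1) = (m : ℕ) := by push_cast; ring
  have h2 : (((m + 1 : ℕ) : ℤ) + 1) = ((m + 1 + 1 : ℕ) : ℤ) := by push_cast; ring
  have hf : ((m + 1 + 1)! : ℝ) = ((m + 1 + 1 : ℕ) : ℝ) * (((m + 1 : ℕ) : ℝ) * m !) := by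
    rw [Nat.factorial_succ, Nat.factorial_succ]
    push_cast
    ring
  unfold realBesselJd
  simp only [h1, h2, Nat.add_sub_cancel, hf]
  have hp : 0 < x / 2 := by positivity
  rw [pow_succ (x / 2) (m + 1), pow_succ (x / 2) m]
  field_simp

lemma tendsToOneRate_besselYd {x : ℝ} (hx : 0 < x) :
    TendsToOneRate fun n => realBesselYd n x * 2 * π * (x / 2) ^ (n + 1) / n ! := by
  have hY := tendsToOneRate_besselY hx
  have hsmall : (fun n : ℕ => -realBesselY (n - 1 : ℕ) x * π * (x / 2) ^ (n - 1) / (n - 1 - 1)! *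
      ((x / 2) ^ 2 * (((n - 1 : ℕ) : ℝ)⁻¹ * (n : ℝ)⁻¹))) =O[atTop] fun n : ℕ => (n : ℝ)⁻¹ := by
    have h := hY.comp_sub_one.isBigO_one.mul (((isBigO_inv_natCast_sub_one.trans
      isBigO_inv_natCast_one).mul (isBigO_refl (fun n : ℕ => (n : ℝ)⁻¹) atTop)).const_mul_left
      ((x / 2) ^ 2))
    simpa using h
  refine (hY.comp_add_one.sub_of_isBigO hsmall).congr' ((eventually_ge_atTop 2).mono fun n hn => ?_)
  obtain ⟨m, rfl⟩ := Nat.exists_eq_add_of_le' hn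
  have h1 : (((m + 2 : ℕ) : ℤ) - 1) = (m + 1 : ℕ) := by push_cast; ring
  have h2 : (((m + 2 : ℕ) : ℤ) + 1) = ((m + 2 + 1 : ℕ) : ℤ) := by push_cast; ring
  have h3 : m + 2 - 1 = m + 1 := rfl
  have hf : ((m + 2)! : ℝ) = ((m + 2 : ℕ) : ℝ) * (((m + 1 : ℕ) : ℝ) * m !) := by
    rw [Nat.factorial_succ, Nat.factorial_succ]
    push_cast
    ring
  unfold realBesselYd
  simp only [h1, h2, h3, Nat.add_sub_cancel, hf]
  have hp : 0 < x / 2 := by positivity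
  rw [pow_succ (x / 2) (m + 2), pow_succ (x / 2) (m + 1)]
  field_simp
  ring

/-- The combination of cylinder functions whose antisymmetrization is `-iβ_n`. -/
def besselCrossProduct (n : ℕ) (a c : ℝ) : ℝ :=
  π / (2 * n) * (a * c * (realBesselJd n a * realBesselYd n c) -
    n ^ 2 * (realBesselJ n a * realBesselY n c))

lemma tendsToOneRate_besselCrossProduct {a c : ℝ} (ha : 0 < a) (hc : 0 < c) :
    TendsToOneRate fun n => besselCrossProduct n a c / (a / c) ^ n := by
  refine (((tendsToOneRate_besselJd ha).mul (tendsToOneRate_besselYd hc)).average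
    ((tendsToOneRate_besselJ ha).mul (tendsToOneRate_besselY hc))).congr'
    ((eventually_ge_atTop 1).mono fun n hn => ?_)
  obtain ⟨m, rfl⟩ := Nat.exists_eq_add_of_le' hn
  have hf : ((m + 1)! : ℝ) = (m + 1) * m ! := by
    rw [Nat.factorial_succ]
    push_cast
    ring
  unfold besselCrossProduct
  simp only [Nat.add_sub_cancel, hf]
  push_cast
  rw [pow_succ (c / 2) (m + 1), pow_succ (a / 2) m, div_pow a 2 m, div_pow c 2, div_pow a c,
    pow_succ a m, pow_succ (2 : ℝ) m]
  field_simp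
  ring

lemma betaN_eq (tp ts : ℝ) (n : ℕ) :
    betaN tp ts n = Complex.I * ((besselCrossProduct n ts tp - besselCrossProduct n tp ts : ℝ) : ℂ) := by
  have hJ : ∀ k x, besselJ k x = (realBesselJ k x : ℂ) := fun _ _ => rfl
  have hY : ∀ k x, besselY k x = (realBesselY k x : ℂ) := fun _ _ => rfl
  unfold betaN besselCrossProduct besselJd besselYd realBesselJd realBesselYd
  simp only [hJ, hY]
  rw [show (π : ℂ) / (2 * Complex.I * ((n : ℤ) : ℂ)) = Complex.I * (-(π / (2 * (n : ℂ)))) by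
    rw [mul_right_comm, ← div_div, Complex.div_I]
    push_cast
    ring]
  push_cast
  ring

lemma pow_add_pow_mul_abs_sub_le {x y : ℝ} (hx : 0 < x) (hy : 0 < y) {n : ℕ} (hn : 1 ≤ n) :
    (x ^ n + y ^ n) * |x - y| ≤ (x + y) * |x ^ n - y ^ n| := by
  wlog hxy : y ≤ x generalizing x y
  · have h := this hy hx (le_of_not_ge hxy)
    rwa [abs_sub_comm, abs_sub_comm (y ^ n), add_comm, add_comm y] at h
  obtain ⟨m, rfl⟩ := Nat.exists_eq_add_of_le' hn
  have h1 : y ^ m ≤ x ^ m := pow_le_pow_left₀ hy.le hxy m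
  have h2 : y ^ (m + 1) ≤ x ^ (m + 1) := pow_le_pow_left₀ hy.le hxy (m + 1)
  rw [abs_of_nonneg (sub_nonneg.2 hxy), abs_of_nonneg (sub_nonneg.2 h2), pow_succ, pow_succ]
  nlinarith [mul_le_mul_of_nonneg_left h1 (mul_pos hx hy).le]

lemma abs_besselCrossProduct_sub_le {tp ts : ℝ} (hp : 0 < tp) (hs : 0 < ts) :
    ∃ C > (0 : ℝ), ∀ᶠ n : ℕ in atTop,
      |(besselCrossProduct n ts tp - besselCrossProduct n tp ts) - (((tp / ts)⁻¹) ^ n - (tp / ts) ^ n)| ≤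
        C / n * |((tp / ts)⁻¹) ^ n - (tp / ts) ^ n| := by
  by_cases hτ1 : tp / ts = 1
  · refine ⟨1, one_pos, .of_forall fun n => ?_⟩
    rw [(div_eq_one_iff_eq hs.ne').1 hτ1]
    simp [hs.ne']
  set τ := tp / ts with hτ
  have hτ0 : 0 < τ := by positivity
  have hτi : ts / tp = τ⁻¹ := by rw [hτ, inv_div]
  obtain ⟨C₁, hC₁, h₁⟩ := (tendsToOneRate_besselCrossProduct hs hp).exists_pos
  obtain ⟨C₂, hC₂, h₂⟩ := (tendsToOneRate_besselCrossProduct hp hs).exists_pos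
  have hd : 0 < |τ⁻¹ - τ| := by
    rw [abs_pos, sub_ne_zero]
    intro h
    have h2 : τ * τ = 1 := by
      nth_rewrite 1 [← h]
      exact inv_mul_cancel₀ hτ0.ne'
    exact hτ1 (by nlinarith)
  refine ⟨(C₁ + C₂) * ((τ⁻¹ + τ) / |τ⁻¹ - τ|), by positivity, ?_⟩
  filter_upwards [h₁.bound, h₂.bound, eventually_ge_atTop 1] with n hn₁ hn₂ hn
  have hn0 : (0 : ℝ) < n := by exact_mod_cast hn
  rw [norm_inv, RCLike.norm_natCast, Real.norm_eq_abs, hτi] at hn₁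
  rw [norm_inv, RCLike.norm_natCast, Real.norm_eq_abs, ← hτ] at hn₂
  have e₁ : besselCrossProduct n ts tp - (τ⁻¹) ^ n =
      (besselCrossProduct n ts tp / (τ⁻¹) ^ n - 1) * (τ⁻¹) ^ n := by field_simp
  have e₂ : besselCrossProduct n tp ts - τ ^ n = (besselCrossProduct n tp ts / τ ^ n - 1) * τ ^ n := by
    field_simp
  calc _ = |(besselCrossProduct n ts tp / (τ⁻¹) ^ n - 1) * (τ⁻¹) ^ n -
        (besselCrossProduct n tp ts / τ ^ n - 1) * τ ^ n| := by
        rw [← e₁, ← e₂]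
        congr 1
        ring
    _ ≤ C₁ * (n : ℝ)⁻¹ * (τ⁻¹) ^ n + C₂ * (n : ℝ)⁻¹ * τ ^ n := by
        refine (abs_sub _ _).trans ?_
        rw [abs_mul, abs_mul, abs_of_pos (by positivity : 0 < (τ⁻¹) ^ n),
          abs_of_pos (by positivity : 0 < τ ^ n)]
        gcongr
    _ ≤ (C₁ + C₂) * (n : ℝ)⁻¹ * ((τ⁻¹) ^ n + τ ^ n) := by
        have h1 : 0 ≤ C₁ * (n : ℝ)⁻¹ * τ ^ n := by positivity
        have h2 : 0 ≤ C₂ * (n : ℝ)⁻¹ * (τ⁻¹) ^ n := by positivity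
        linarith
    _ ≤ (C₁ + C₂) * (n : ℝ)⁻¹ * ((τ⁻¹ + τ) / |τ⁻¹ - τ| * |(τ⁻¹) ^ n - τ ^ n|) := by
        gcongr
        rw [div_mul_eq_mul_div, le_div_iff₀ hd]
        exact pow_add_pow_mul_abs_sub_le (inv_pos.2 hτ0) hτ0 hn
    _ = _ := by ring

lemma sqrt_sq_add_four_sub_inv {u : ℝ} (hu : 0 < u) : √((u - u⁻¹) ^ 2 + 4) = u + u⁻¹ := by
  rw [show (u - u⁻¹) ^ 2 + 4 = (u + u⁻¹) ^ 2 by field_simp; ring]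
  exact Real.sqrt_sq (by positivity)

/-- The positive root of `s - s⁻¹ = b`. -/
def posRoot (b : ℝ) : ℝ := (b + √(b ^ 2 + 4)) / 2

lemma posRoot_pos (b : ℝ) : 0 < posRoot b := by
  have h : |b| < √(b ^ 2 + 4) := Real.lt_sqrt_of_sq_lt (by rw [sq_abs]; linarith)
  have := neg_abs_le b
  unfold posRoot
  linarith

lemma inv_posRoot (b : ℝ) : (posRoot b)⁻¹ = (√(b ^ 2 + 4) - b) / 2 := by
  have h := Real.sq_sqrt (by positivity : 0 ≤ b ^ 2 + 4)
  refine inv_eq_of_mul_eq_one_right ?_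
  unfold posRoot
  linarith

lemma posRoot_sub_inv (b : ℝ) : posRoot b - (posRoot b)⁻¹ = b := by
  rw [inv_posRoot, posRoot]
  ring

lemma cpow_half_betaN_sq (b : ℝ) :
    ((Complex.I * (b : ℂ)) ^ 2 - 4) ^ ((1 : ℂ) / 2) = Complex.I * (√(b ^ 2 + 4) : ℝ) := by
  have h : (Complex.I * (b : ℂ)) ^ 2 - 4 = ((-(b ^ 2 + 4) : ℝ) : ℂ) := by
    rw [mul_pow, Complex.I_sq]
    push_cast
    ring
  rw [h, Complex.ofReal_cpow_of_nonpos (by nlinarith [sq_nonneg b])]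
  rw [← Complex.ofReal_neg, neg_neg, Real.sqrt_eq_rpow,
    Complex.ofReal_cpow (by positivity), mul_comm]
  congr 1
  · rw [show (π : ℂ) * Complex.I * (1 / 2) = π / 2 * Complex.I by ring, Complex.exp_pi_div_two_mul_I]
  · push_cast
    rfl

lemma abs_sub_le_of_one_le {s u ε : ℝ} (hs : 0 < s) (hu : 1 ≤ u) (hε : ε ≤ 1 / 2)
    (hε0 : 0 ≤ ε) (h : |(s - s⁻¹) - (u - u⁻¹)| ≤ ε * |u - u⁻¹|) :
    |s - u| ≤ 2 * ε * u ∧ |s⁻¹ - u⁻¹| ≤ 2 * ε * u⁻¹ := by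
  have hu0 : 0 < u := by linarith
  have hsu : 0 < s * u := mul_pos hs hu0
  have hui : u⁻¹ ≤ 1 := inv_le_one_of_one_le₀ hu
  have hui0 : 0 < u⁻¹ := inv_pos.2 hu0
  rw [abs_of_nonneg (by linarith : 0 ≤ u - u⁻¹)] at h
  have heq : (s - s⁻¹) - (u - u⁻¹) = (s - u) * (1 + (s * u)⁻¹) := by
    field_simp
    ring
  rw [heq, abs_mul, abs_of_pos (by positivity : 0 < 1 + (s * u)⁻¹)] at h
  have hle : |s - u| * (1 + (s * u)⁻¹) ≤ ε * u :=
    h.trans (mul_le_mul_of_nonneg_left (by linarith) hε0)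
  have hsui : 0 ≤ |s - u| * (s * u)⁻¹ := by positivity
  have h1 : |s - u| ≤ ε * u := by linarith
  refine ⟨h1.trans (by nlinarith), ?_⟩
  have h2 : |s - u| * (s * u)⁻¹ ≤ ε * u * (s * u)⁻¹ := by gcongr
  have heq' : s⁻¹ - u⁻¹ = -((s - u) * (s * u)⁻¹) := by
    field_simp
    ring
  have hs2 : u / 2 ≤ s := by nlinarith [neg_abs_le (s - u)]
  rw [heq', abs_neg, abs_mul, abs_of_pos (inv_pos.2 hsu)]
  calc _ ≤ ε * u * (s * u)⁻¹ := h2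
    _ = ε * s⁻¹ := by field_simp
    _ ≤ ε * (u / 2)⁻¹ := by gcongr
    _ = 2 * ε * u⁻¹ := by field_simp

lemma abs_sub_le_of_sub_inv {s u ε : ℝ} (hs : 0 < s) (hu : 0 < u) (hε : ε ≤ 1 / 2)
    (hε0 : 0 ≤ ε) (h : |(s - s⁻¹) - (u - u⁻¹)| ≤ ε * |u - u⁻¹|) :
    |s - u| ≤ 2 * ε * u ∧ |s⁻¹ - u⁻¹| ≤ 2 * ε * u⁻¹ := by
  rcases le_total 1 u with h1 | h1
  · exact abs_sub_le_of_one_le hs h1 hε hε0 h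
  · have h' := abs_sub_le_of_one_le (inv_pos.2 hs) ((one_le_inv₀ hu).2 h1) hε hε0 (by
      rw [inv_inv, inv_inv, abs_sub_comm u⁻¹ u, abs_sub_comm]
      convert h using 2
      ring)
    rw [inv_inv, inv_inv] at h'
    exact h'.symm

lemma abs_sqrt_sq_add_four_sub_le (b c : ℝ) : |√(b ^ 2 + 4) - √(c ^ 2 + 4)| ≤ |b - c| := by
  have hb := Real.sq_sqrt (by positivity : 0 ≤ b ^ 2 + 4)
  have hc := Real.sq_sqrt (by positivity : 0 ≤ c ^ 2 + 4)
  refine abs_le_of_sq_le_sq' ?_ (abs_nonneg _) |> abs_le.2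
  rw [sq_abs]
  have hbc : b * c + 4 ≤ √(b ^ 2 + 4) * √(c ^ 2 + 4) := by
    rw [← Real.sqrt_mul (by positivity)]
    exact Real.le_sqrt_of_sq_le (by nlinarith [sq_nonneg (b - c)])
  nlinarith

lemma norm_I_mul_ofReal (r : ℝ) : ‖Complex.I * (r : ℂ)‖ = |r| := by
  rw [norm_mul, Complex.norm_I, one_mul, Complex.norm_real, Real.norm_eq_abs]

/-- Remark 5.5: with `τ = t_p/t_s`, the large-`n` asymptotics
`βₙ = i(τ^{−n} − τⁿ)(1+O(1/n))`, `√(βₙ²−4) = i(τ^{−n} + τⁿ)(1+O(1/n))`,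
`σ₁⁽ⁿ⁾ = iτⁿ(1+O(1/n))`, `σ₂⁽ⁿ⁾ = −iτ^{−n}(1+O(1/n))` hold as `n → +∞`. -/
theorem sigma_beta_asymptotics
    (μ lam ω R : ℝ) (hμ : 0 < μ) (hlam : 0 < lam + 2 * μ) (hω : 0 < ω) (hR : 0 < R)
    (kp ks tp ts : ℝ)
    (hkp : kp = kpOf μ lam ω) (hks : ks = ksOf μ ω) (htp : tp = kp * R) (hts : ts = ks * R) :
    (∃ C > (0 : ℝ), ∃ N : ℕ, ∀ n : ℕ, N ≤ n →
      ‖betaN tp ts (n : ℤ)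
          - Complex.I * (((tp / ts : ℝ) : ℂ) ^ (-(n : ℤ)) - ((tp / ts : ℝ) : ℂ) ^ (n : ℤ))‖
        ≤ C / (n : ℝ) *
          ‖((tp / ts : ℝ) : ℂ) ^ (-(n : ℤ)) - ((tp / ts : ℝ) : ℂ) ^ (n : ℤ)‖) ∧
    (∃ C > (0 : ℝ), ∃ N : ℕ, ∀ n : ℕ, N ≤ n →
      ‖(betaN tp ts (n : ℤ) ^ 2 - 4) ^ ((1 : ℂ) / 2)
          - Complex.I * (((tp / ts : ℝ) : ℂ) ^ (-(n : ℤ)) + ((tp / ts : ℝ) : ℂ) ^ (n : ℤ))‖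
        ≤ C / (n : ℝ) *
          ‖((tp / ts : ℝ) : ℂ) ^ (-(n : ℤ)) + ((tp / ts : ℝ) : ℂ) ^ (n : ℤ)‖) ∧
    (∃ C > (0 : ℝ), ∃ N : ℕ, ∀ n : ℕ, N ≤ n →
      ‖sigmaRoot tp ts (n : ℤ) 0 - Complex.I * ((tp / ts : ℝ) : ℂ) ^ (n : ℤ)‖
        ≤ C / (n : ℝ) * ‖((tp / ts : ℝ) : ℂ) ^ (n : ℤ)‖) ∧
    (∃ C > (0 : ℝ), ∃ N : ℕ, ∀ n : ℕ, N ≤ n →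
      ‖sigmaRoot tp ts (n : ℤ) 1 + Complex.I * ((tp / ts : ℝ) : ℂ) ^ (-(n : ℤ))‖
        ≤ C / (n : ℝ) * ‖((tp / ts : ℝ) : ℂ) ^ (-(n : ℤ))‖) := by
  have hp : 0 < tp := by
    rw [htp, hkp, kpOf]
    positivity
  have hs : 0 < ts := by
    rw [hts, hks, ksOf]
    positivity
  have hτ0 : 0 < tp / ts := by positivity
  obtain ⟨C, hC, hev⟩ := abs_besselCrossProduct_sub_le hp hs
  obtain ⟨N₀, hN₀⟩ := eventually_atTop.1 hev
  set τ := tp / ts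
  set B : ℕ → ℝ := fun n => besselCrossProduct n ts tp - besselCrossProduct n tp ts with hB
  have hβ : ∀ n : ℕ, betaN tp ts (n : ℤ) = Complex.I * (B n : ℂ) := betaN_eq tp ts
  have hz : ∀ n : ℕ, (τ : ℂ) ^ (-(n : ℤ)) = (((τ ^ n)⁻¹ : ℝ) : ℂ) := fun n => by
    rw [zpow_neg, zpow_natCast]
    push_cast
    rfl
  have hz' : ∀ n : ℕ, (τ : ℂ) ^ (n : ℤ) = ((τ ^ n : ℝ) : ℂ) := fun n => by
    rw [zpow_natCast]
    push_cast
    rfl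
  have hb : ∀ n ≥ N₀, |B n - ((τ ^ n)⁻¹ - τ ^ n)| ≤ C / n * |(τ ^ n)⁻¹ - τ ^ n| := by
    simpa only [inv_pow] using hN₀
  have hsqrt : ∀ n : ℕ, (betaN tp ts (n : ℤ) ^ 2 - 4) ^ ((1 : ℂ) / 2) =
      Complex.I * (√(B n ^ 2 + 4) : ℝ) := fun n => by rw [hβ, cpow_half_betaN_sq]
  have hσ₀ : ∀ n : ℕ, sigmaRoot tp ts (n : ℤ) 0 = Complex.I * (((posRoot (B n))⁻¹ : ℝ) : ℂ) := by
    intro n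
    rw [sigmaRoot, hsqrt, hβ, inv_posRoot]
    push_cast
    ring
  have hσ₁ : ∀ n : ℕ, sigmaRoot tp ts (n : ℤ) 1 = -(Complex.I * ((posRoot (B n) : ℝ) : ℂ)) := by
    intro n
    rw [sigmaRoot, hsqrt, hβ, posRoot]
    push_cast
    ring
  obtain ⟨N₁, hN₁⟩ := exists_nat_ge (2 * C)
  have hroots : ∀ n ≥ max N₀ (max N₁ 1),
      |posRoot (B n) - (τ ^ n)⁻¹| ≤ 2 * C / n * (τ ^ n)⁻¹ ∧
        |(posRoot (B n))⁻¹ - τ ^ n| ≤ 2 * C / n * τ ^ n := by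
    intro n hn
    simp only [ge_iff_le, max_le_iff] at hn
    have hn0 : (0 : ℝ) < n := by exact_mod_cast hn.2.2
    have hCn : C / n ≤ 1 / 2 := by
      rw [div_le_div_iff₀ hn0 two_pos]
      have : (N₁ : ℝ) ≤ n := by exact_mod_cast hn.2.1
      linarith
    have h := abs_sub_le_of_sub_inv (posRoot_pos (B n)) (u := (τ ^ n)⁻¹) (by positivity) hCn
      (by positivity) (by rw [posRoot_sub_inv, inv_inv]; exact hb n hn.1)
    rwa [inv_inv, ← mul_div_assoc] at h
  simp only [hσ₀, hσ₁, hsqrt]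
  simp only [hβ, hz, hz', ← Complex.ofReal_sub, ← Complex.ofReal_add, ← mul_sub,
    norm_I_mul_ofReal, Complex.norm_real, Real.norm_eq_abs, neg_add_eq_sub]
  refine ⟨⟨C, hC, N₀, hb⟩, ⟨C, hC, N₀, fun n hn => ?_⟩,
    ⟨2 * C, by positivity, max N₀ (max N₁ 1), fun n hn => ?_⟩,
    ⟨2 * C, by positivity, max N₀ (max N₁ 1), fun n hn => ?_⟩⟩
  · have hu : 0 < (τ ^ n)⁻¹ := by positivity
    have hs := sqrt_sq_add_four_sub_inv hu
    rw [inv_inv] at hs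
    rw [← hs]
    refine (abs_sqrt_sq_add_four_sub_le _ _).trans ((hb n hn).trans ?_)
    refine mul_le_mul_of_nonneg_left ?_ (by positivity)
    exact (Real.abs_le_sqrt (le_add_of_nonneg_right zero_le_four)).trans (le_abs_self _)
  · rw [abs_of_pos (pow_pos hτ0 n)]
    exact (hroots n hn).2
  · rw [abs_of_pos (inv_pos.2 (pow_pos hτ0 n)), abs_sub_comm]
    exact (hroots n hn).1
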